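/- arXiv:2411.18569 — 3 statements merged into one kernel-verified Lean document; each statement's English description precedes it below -/
import Mathlib

section
/- (Key lemma for the zoom correction.) Let X ∈ ℝ^m have a unique maximizer î = argmax_{j∈[m]} X_j. Fix t ∈ ℝ and define the worst-case vector θ^t ∈ ℝ^m by θ^t_î = t and θ^t_j = min{ (2/3)X_j + (1/3)t, t } for j ≠ î. Then t belongs to the projected confidence set Ĉ^α_î = { θ_î : θ ∈ ℝ^m, X ∈ A_α(θ) } if and only if |X_î − t| ≤ r_α(θ^t). -/
open Set

noncomputable section

/-- Suboptimality gap `Δ_j(θ) = max_i θ_i − θ_j`. -/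
def gapv {m : ℕ} (θ : Fin m → ℝ) (j : Fin m) : ℝ := (⨆ i, θ i) - θ j

/-- Active radius `r_α(θ) = min {r ≥ 0 : 𝐒((max{r, Δ_j(θ)/2})_j) ≤ α}`. -/
def rA {m : ℕ} (S : (Fin m → ℝ) → ℝ) (α : ℝ) (θ : Fin m → ℝ) : ℝ :=
  sInf {r : ℝ | 0 ≤ r ∧ S (fun j => max r (gapv θ j / 2)) ≤ α}

/-- Acceptance-region membership: `x ∈ A_α(θ)`. -/
def accept {m : ℕ} (S : (Fin m → ℝ) → ℝ) (α : ℝ) (θ x : Fin m → ℝ) : Prop :=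
  ∀ j, |x j - θ j| ≤ max (rA S α θ) (gapv θ j / 2)

/-- The worst-case vector `θ^t`: `θ^t_î = t`, `θ^t_j = min{(2/3)X_j + (1/3)t, t}`
for `j ≠ î`. -/
def thetaT {m : ℕ} (X : Fin m → ℝ) (ih : Fin m) (t : ℝ) : Fin m → ℝ :=
  fun j => if j = ih then t else min (2 / 3 * X j + 1 / 3 * t) t

theorem zk_mono {m : ℕ} (S : (Fin m → ℝ) → ℝ)
    (hSanti : ∀ v : Fin m → ℝ, (∀ j, 0 ≤ v j) → ∀ (j : Fin m) (a b : ℝ),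
      0 ≤ a → a < b → S (Function.update v j b) < S (Function.update v j a))
    (v w : Fin m → ℝ) (hv : ∀ j, 0 ≤ v j) (hvw : ∀ j, v j ≤ w j) : S w ≤ S v := by
  have key : ∀ s : Finset (Fin m), S (s.piecewise w v) ≤ S v := by
    intro s
    induction s using Finset.induction_on with
    | empty => simp
    | insert a s ha IH =>
      refine le_trans ?_ IH
      rw [Finset.piecewise_insert]
      have h0 : ∀ j, 0 ≤ s.piecewise w v j := by
        intro j
        by_cases hj : j ∈ s
        · simp [hj, (hv j).trans (hvw j)]
        · simp [hj, hv j]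
      have e : s.piecewise w v = Function.update (s.piecewise w v) a (v a) := by
        conv_lhs => rw [← Function.update_eq_self a (s.piecewise w v)]
        simp [ha]
      rcases (hvw a).eq_or_lt with h | h
      · rw [← h, ← e]
      · have := hSanti _ h0 a (v a) (w a) (hv a) h
        rw [← e] at this
        exact this.le
  simpa using key Finset.univ

theorem zk_strict {m : ℕ} (S : (Fin m → ℝ) → ℝ)
    (hSanti : ∀ v : Fin m → ℝ, (∀ j, 0 ≤ v j) → ∀ (j : Fin m) (a b : ℝ),
      0 ≤ a → a < b → S (Function.update v j b) < S (Function.update v j a))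
    (v w : Fin m → ℝ) (hv : ∀ j, 0 ≤ v j) (hvw : ∀ j, v j ≤ w j) (i : Fin m)
    (hi : v i < w i) : S w < S v := by
  have h1 := hSanti w (fun j => (hv j).trans (hvw j)) i (v i) (w i) (hv i) hi
  rw [Function.update_eq_self] at h1
  refine h1.trans_le (zk_mono S hSanti _ _ hv ?_)
  intro j
  by_cases hj : j = i
  · subst hj; simp
  · simp [hj, hvw j]

theorem zk_gap_nonneg {m : ℕ} (θ : Fin m → ℝ) (j : Fin m) : 0 ≤ gapv θ j :=
  sub_nonneg.2 (le_ciSup (Set.finite_range θ).bddAbove j)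

theorem zk_rA_nonneg {m : ℕ} (S : (Fin m → ℝ) → ℝ) (α : ℝ) (θ : Fin m → ℝ) :
    0 ≤ rA S α θ := Real.sInf_nonneg (fun _ hx => hx.1)

theorem zk_rA_le {m : ℕ} (α : ℝ) (hα0 : 0 < α)
    (S : (Fin m → ℝ) → ℝ)
    (hScont : ContinuousOn S {v : Fin m → ℝ | ∀ j, 0 ≤ v j})
    (hSanti : ∀ v : Fin m → ℝ, (∀ j, 0 ≤ v j) → ∀ (j : Fin m) (a b : ℝ),
      0 ≤ a → a < b → S (Function.update v j b) < S (Function.update v j a))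
    (hSlim : ∀ ε : ℝ, 0 < ε → ∃ M : ℝ, ∀ v : Fin m → ℝ, (∀ j, M ≤ v j) → S v < ε)
    (θ η : Fin m → ℝ) (i : Fin m) (hi : gapv η i = 0)
    (h : ∀ j, gapv η j / 2 ≤ max (rA S α θ) (gapv θ j / 2)) :
    rA S α θ ≤ rA S α η := by
  by_contra! hlt
  have hne : {r : ℝ | 0 ≤ r ∧ S (fun j => max r (gapv η j / 2)) ≤ α}.Nonempty := by
    obtain ⟨M, hM⟩ := hSlim α hα0
    exact ⟨max M 0, le_max_right _ _,
      (hM _ (fun j => (le_max_left M 0).trans (le_max_left _ _))).le⟩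
  obtain ⟨s, ⟨hs0, hsα⟩, hsr⟩ := exists_lt_of_csInf_lt hne hlt
  have hr0 : 0 < rA S α θ := hs0.trans_lt hsr
  have hSr : S (fun j => max (rA S α θ) (gapv θ j / 2)) < α := by
    refine (zk_strict S hSanti (fun j => max s (gapv η j / 2)) _
      (fun j => hs0.trans (le_max_left _ _)) ?_ i ?_).trans_le hsα
    · intro j
      exact max_le (hsr.le.trans (le_max_left _ _)) (h j)
    · simp only [hi]
      refine lt_of_lt_of_le ?_ (le_max_left _ _)
      simpa using ⟨hsr, hr0⟩
  have hc : ContinuousOn (fun r : ℝ => S (fun j => max r (gapv θ j / 2))) (Ici 0) := by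
    refine hScont.comp (f := fun r : ℝ => (fun j => max r (gapv θ j / 2))) ?_ ?_
    · exact Continuous.continuousOn (by fun_prop)
    · intro r hr j
      exact le_trans hr (le_max_left _ _)
  have hca := hc.continuousAt (Ici_mem_nhds hr0)
  have hev := (hca.eventually_lt continuousAt_const hSr).and (Ici_mem_nhds hr0)
  have hev2 := (hev.filter_mono (nhdsWithin_le_nhds (s := Iio (rA S α θ)))).and
    self_mem_nhdsWithin
  obtain ⟨r', ⟨h1, h2⟩, h3⟩ := hev2.exists
  have : rA S α θ ≤ r' := csInf_le ⟨0, fun x hx => hx.1⟩ ⟨h2, h1.le⟩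
  exact absurd h3 (not_lt.2 this)

theorem zk_gapT {m : ℕ} (X : Fin m → ℝ) (ih : Fin m) (t : ℝ) (j : Fin m) :
    gapv (thetaT X ih t) j = t - thetaT X ih t j := by
  have : Nonempty (Fin m) := ⟨ih⟩
  have hs : (⨆ i, thetaT X ih t i) = t := by
    apply le_antisymm
    · refine ciSup_le fun i => ?_
      unfold thetaT
      split_ifs
      · exact le_rfl
      · exact min_le_right _ _
    · have := le_ciSup (Set.finite_range (thetaT X ih t)).bddAbove ih
      have e : thetaT X ih t ih = t := by simp [thetaT]
      rwa [e] at this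
  rw [gapv, hs]

/-- **Key lemma for the zoom correction.** For `X` with unique maximizer `î`,
`t ∈ Ĉ^α_î = {θ_î : X ∈ A_α(θ)}` if and only if `|X_î − t| ≤ r_α(θ^t)`. -/
theorem zoom_key_lemma
    (m : ℕ) (hm : 0 < m) (α : ℝ) (hα0 : 0 < α) (hα1 : α < 1)
    (S : (Fin m → ℝ) → ℝ)
    (hS0 : ∀ v : Fin m → ℝ, (∀ j, 0 ≤ v j) → 0 ≤ S v)
    (hScont : ContinuousOn S {v : Fin m → ℝ | ∀ j, 0 ≤ v j})
    (hSanti : ∀ v : Fin m → ℝ, (∀ j, 0 ≤ v j) → ∀ (j : Fin m) (a b : ℝ),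
      0 ≤ a → a < b → S (Function.update v j b) < S (Function.update v j a))
    (hSlim : ∀ ε : ℝ, 0 < ε → ∃ M : ℝ, ∀ v : Fin m → ℝ, (∀ j, M ≤ v j) → S v < ε)
    (X : Fin m → ℝ) (ih : Fin m) (hih : ∀ j, j ≠ ih → X j < X ih)
    (t : ℝ) :
    (∃ θ : Fin m → ℝ, accept S α θ X ∧ θ ih = t) ↔
      |X ih - t| ≤ rA S α (thetaT X ih t) := by
  have hgi : gapv (thetaT X ih t) ih = 0 := by rw [zk_gapT]; simp [thetaT]
  constructor
  · rintro ⟨θ, hacc, rfl⟩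
    have : Nonempty (Fin m) := ⟨ih⟩
    obtain ⟨k, hk⟩ := exists_eq_ciSup_of_finite (f := θ)
    have hr := zk_rA_nonneg S α θ
    have hk1 := hacc k
    have hih1 := hacc ih
    have hk0 : gapv θ k = 0 := by rw [gapv, hk, sub_self]
    have hXk : X k ≤ X ih ∧ (k ≠ ih → X k < X ih) := by
      refine ⟨?_, hih k⟩
      by_cases h : k = ih
      · rw [h]
      · exact (hih k h).le
    have hrle : rA S α θ ≤ rA S α (thetaT X ih (θ ih)) := by
      refine zk_rA_le α hα0 S hScont hSanti hSlim _ _ ih hgi fun j => ?_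
      rw [zk_gapT]
      have hj := hacc j
      have hg := zk_gap_nonneg θ j
      have hle : θ ih ≤ ⨆ i, θ i := le_ciSup (Set.finite_range θ).bddAbove ih
      have hdef : gapv θ j = (⨆ i, θ i) - θ j := rfl
      have hj2 := (abs_le.1 hj).1
      unfold thetaT
      split_ifs with hji
      · simp [hr]
      · rcases min_cases (2 / 3 * X j + 1 / 3 * θ ih) (θ ih) with ⟨e, _⟩ | ⟨e, _⟩ <;> rw [e] <;>
        rcases max_cases (rA S α θ) (gapv θ j / 2) with ⟨e, _⟩ | ⟨e, _⟩ <;> rw [e] at hj2 ⊢ <;>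
        linarith
    refine le_trans ?_ hrle
    by_cases hki : k = ih
    · subst hki
      rw [hk0] at hk1
      simpa [hr] using hk1
    · have hlt := hXk.2 hki
      rw [hk0, zero_div, max_eq_left hr] at hk1
      have hdef : gapv θ ih = (⨆ i, θ i) - θ ih := rfl
      rcases le_total (gapv θ ih / 2) (rA S α θ) with h | h
      · rwa [max_eq_left h] at hih1
      · rw [max_eq_right h] at hih1
        have := (abs_le.1 hk1).1
        have := (abs_le.1 hih1).2
        linarith
  · intro h
    refine ⟨thetaT X ih t, fun j => ?_, by simp [thetaT]⟩
    by_cases hj : j = ih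
    · subst hj
      refine le_trans ?_ (le_max_left _ _)
      simpa [thetaT] using h
    · rw [zk_gapT]
      have hlt := hih j hj
      have h2 := (abs_le.1 h).2
      have e : thetaT X ih t j = min (2 / 3 * X j + 1 / 3 * t) t := by simp [thetaT, hj]
      rw [e]
      rcases min_cases (2 / 3 * X j + 1 / 3 * t) t with ⟨e, h3⟩ | ⟨e, h3⟩ <;> rw [e]
      · refine le_trans ?_ (le_max_right _ _)
        rw [abs_le]; constructor <;> linarith
      · refine le_trans ?_ (le_max_left _ _)
        rw [abs_le]; constructor <;> linarith
end
end

section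
/- (Endpoint equations under a union bound.) Suppose 𝐒(v) = Σ_{i=1}^m S(v_i), where S : [0,∞) → [0,1] is continuous, strictly decreasing, with S(0) = 1 and S(r) → 0 as r → ∞. Let X ∈ ℝ^m have a unique maximizer î, let Δ̂_j = X_î − X_j, and let t_l = min Ĉ^α_î and t_u = max Ĉ^α_î with lower radius r_l = X_î − t_l and upper radius r_u = t_u − X_î. Then r_l solves the equation α = Σ_{j=1}^m S( max{ r, (Δ̂_j − r)/3 } ), and r_u solves the equation α = Σ_{j=1}^m S( max{ r, (Δ̂_j + r)/3 } ). -/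
open Set

noncomputable section

/-- The zoom-correction confidence set `Ĉ^α_î = {t : |X_î − t| ≤ r_α(θ^t)}`. -/
def Chat {m : ℕ} (S : (Fin m → ℝ) → ℝ) (α : ℝ) (X : Fin m → ℝ) (ih : Fin m) : Set ℝ :=
  {t : ℝ | |X ih - t| ≤ rA S α (thetaT X ih t)}

lemma gapv_thetaT {m : ℕ} (X : Fin m → ℝ) (ih : Fin m) (t : ℝ) (j : Fin m) :
    gapv (thetaT X ih t) j / 2 = if j = ih then 0 else max ((t - X j) / 3) 0 := by
  have hle : ∀ i, thetaT X ih t i ≤ t := by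
    intro i
    unfold thetaT
    split_ifs
    · exact le_rfl
    · exact min_le_right _ _
  have hsup : (⨆ i, thetaT X ih t i) = t := by
    have : Nonempty (Fin m) := ⟨ih⟩
    apply le_antisymm
    · exact ciSup_le hle
    · have h := le_ciSup (f := thetaT X ih t) ⟨t, by rintro _ ⟨i, rfl⟩; exact hle i⟩ ih
      have h2 : thetaT X ih t ih = t := by simp [thetaT]
      rw [h2] at h
      exact h
  unfold gapv
  rw [hsup]
  unfold thetaT
  split_ifs with h
  · simp
  · rcases le_total (X j) t with h1 | h1
    · rw [min_eq_left (by linarith), max_eq_left (by linarith)]; ring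
    · rw [min_eq_right (by linarith), max_eq_right (by linarith)]; ring

/-- **Endpoint equations under a union bound.** With `𝐒(v) = Σ_i S(v_i)`,
the lower radius `r_l = X_î − t_l` solves `α = Σ_j S(max{r, (Δ̂_j − r)/3})`
and the upper radius `r_u = t_u − X_î` solves `α = Σ_j S(max{r, (Δ̂_j + r)/3})`,
where `Δ̂_j = X_î − X_j`, `t_l = min Ĉ^α_î`, `t_u = max Ĉ^α_î`. -/
theorem endpoint_equations
    (m : ℕ) (hm : 0 < m) (α : ℝ) (hα0 : 0 < α) (hα1 : α < 1)
    (S : ℝ → ℝ)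
    (hScont : ContinuousOn S (Set.Ici (0 : ℝ)))
    (hSanti : StrictAntiOn S (Set.Ici (0 : ℝ)))
    (hS1 : S 0 = 1)
    (hSrange : ∀ r : ℝ, 0 ≤ r → 0 ≤ S r ∧ S r ≤ 1)
    (hSlim : Filter.Tendsto S Filter.atTop (nhds 0))
    (X : Fin m → ℝ) (ih : Fin m) (hih : ∀ j, j ≠ ih → X j < X ih)
    (tl tu rl ru : ℝ)
    (htl : tl = sInf (Chat (fun v => ∑ i, S (v i)) α X ih))
    (htu : tu = sSup (Chat (fun v => ∑ i, S (v i)) α X ih))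
    (hrl : rl = X ih - tl) (hru : ru = tu - X ih) :
    α = ∑ j, S (max rl ((X ih - X j - rl) / 3)) ∧
    α = ∑ j, S (max ru ((X ih - X j + ru) / 3)) := by
  set T : ℝ → ℝ := fun r => S (max r 0) with hT
  have hTc : Continuous T :=
    hScont.comp_continuous (continuous_id.max continuous_const) (fun x => Set.mem_Ici.mpr (le_max_right _ _))
  have hTS : ∀ r, 0 ≤ r → T r = S r := fun r hr => by simp [hT, max_eq_left hr]
  have hTanti : Antitone T := fun a b hab =>
    hSanti.antitoneOn (Set.mem_Ici.mpr (le_max_right _ _)) (Set.mem_Ici.mpr (le_max_right _ _)) (max_le_max_right 0 hab)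
  have hT0 : ∀ r, 0 ≤ T r := fun r => (hSrange _ (le_max_right _ _)).1
  set c : Fin m → ℝ → ℝ := fun j t => if j = ih then 0 else (t - X j) / 3 with hc
  have hcc : ∀ j, Continuous (c j) := by
    intro j
    by_cases h : j = ih
    · simp only [hc, h, if_true]; exact continuous_const
    · simp only [hc, h, if_false]; fun_prop
  set f : ℝ → ℝ → ℝ := fun t r => ∑ j, T (max r (c j t)) with hf
  have hfeq : ∀ t r, 0 ≤ r →
      ∑ j, S (max r (gapv (thetaT X ih t) j / 2)) = f t r := by
    intro t r hr
    refine Finset.sum_congr rfl fun j _ => ?_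
    rw [gapv_thetaT, hTS _ (le_max_of_le_left hr)]
    congr 1
    by_cases h : j = ih
    · simp [hc, h]
    · simp only [hc, h, if_false]
      rw [max_comm ((t - X j) / 3) 0, ← max_assoc, max_eq_left hr]
  have hfc : ∀ t, Continuous (f t) := fun t =>
    continuous_finsetSum _ fun j _ => hTc.comp (continuous_id.max continuous_const)
  have hf0 : ∀ t, 1 ≤ f t 0 := by
    intro t
    have h := Finset.single_le_sum (f := fun j => T (max 0 (c j t))) (fun j _ => hT0 _)
      (Finset.mem_univ ih)
    have h2 : T (max 0 (c ih t)) = 1 := by simp [hc, hT, hS1]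
    simp only [h2] at h
    exact h
  have hfanti : ∀ t a b, 0 ≤ a → a < b → f t b < f t a := by
    intro t a b ha hab
    refine Finset.sum_lt_sum (fun j _ => hTanti (max_le_max_right _ hab.le))
      ⟨ih, Finset.mem_univ _, ?_⟩
    have hb : 0 ≤ b := ha.trans hab.le
    simp only [hc, if_true, max_eq_left ha, max_eq_left hb]
    rw [hTS _ ha, hTS _ hb]
    exact hSanti ha hb hab
  have hm' : (0 : ℝ) < m := by exact_mod_cast hm
  obtain ⟨R, hR0, hR⟩ : ∃ R : ℝ, 0 ≤ R ∧ ∀ t r, R ≤ r → f t r < α := by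
    have hev := (hSlim.eventually_lt_const (show (0 : ℝ) < α / m by positivity)).and
      (Filter.eventually_ge_atTop (0 : ℝ))
    obtain ⟨R, hR, hR0⟩ := hev.exists
    refine ⟨R, hR0, fun t r hr => ?_⟩
    have : f t r ≤ ∑ j : Fin m, S R := Finset.sum_le_sum fun j _ => by
      rw [← hTS R hR0]
      exact hTanti (le_max_of_le_left hr)
    rw [Finset.sum_const, Finset.card_univ, Fintype.card_fin, nsmul_eq_mul] at this
    rw [lt_div_iff₀ hm'] at hR
    linarith
  have hmem : ∀ t, t ∈ Chat (fun v => ∑ i, S (v i)) α X ih ↔ α ≤ f t |X ih - t| := by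
    intro t
    have hs : 0 ≤ |X ih - t| := abs_nonneg _
    have hbA : BddBelow {r : ℝ | 0 ≤ r ∧
        ∑ j, S (max r (gapv (thetaT X ih t) j / 2)) ≤ α} := ⟨0, fun r hr => hr.1⟩
    have hnA : {r : ℝ | 0 ≤ r ∧
        ∑ j, S (max r (gapv (thetaT X ih t) j / 2)) ≤ α}.Nonempty :=
      ⟨R, hR0, by simpa only [hfeq t R hR0] using (hR t R le_rfl).le⟩
    change |X ih - t| ≤ sInf {r : ℝ | 0 ≤ r ∧
        ∑ j, S (max r (gapv (thetaT X ih t) j / 2)) ≤ α} ↔ _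
    rw [le_csInf_iff hbA hnA]
    constructor
    · intro h
      by_contra hlt
      push Not at hlt
      have hne : 0 < |X ih - t| := by
        rcases hs.eq_or_lt with h0 | h0
        · rw [← h0] at hlt
          linarith [hf0 t]
        · exact h0
      have h1 : ∀ᶠ r in nhdsWithin |X ih - t| (Set.Iio |X ih - t|), f t r < α :=
        ((hfc t).tendsto _ |>.mono_left nhdsWithin_le_nhds).eventually_lt_const hlt
      have h2 : ∀ᶠ r in nhdsWithin |X ih - t| (Set.Iio |X ih - t|), 0 < r :=
        nhdsWithin_le_nhds (eventually_gt_nhds hne)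
      obtain ⟨r, ⟨hr1, hr2⟩, hr3⟩ := ((h1.and h2).and self_mem_nhdsWithin).exists
      have := h r ⟨hr2.le, by simpa only [hfeq t r hr2.le] using hr1.le⟩
      exact absurd this (not_le.mpr hr3)
    · rintro h a ⟨ha, ha2⟩
      have ha3 : f t a ≤ α := by simpa only [hfeq t a ha] using ha2
      by_contra hlt
      push Not at hlt
      linarith [hfanti t a _ ha hlt]
  have hCeq : Chat (fun v => ∑ i, S (v i)) α X ih = {t | α ≤ f t |X ih - t|} := by
    ext t; exact hmem t
  rw [hCeq] at htl htu
  set G : ℝ → ℝ := fun t => f t |X ih - t| with hG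
  have hGc : Continuous G :=
    continuous_finsetSum _ fun j _ => hTc.comp
      ((continuous_const.sub continuous_id).abs.max (hcc j))
  set C : Set ℝ := {t | α ≤ G t} with hC
  change tl = sInf C at htl
  change tu = sSup C at htu
  have hCcl : IsClosed C := isClosed_le continuous_const hGc
  have hXC : X ih ∈ C := by
    change α ≤ f (X ih) |X ih - X ih|
    rw [sub_self, abs_zero]
    linarith [hf0 (X ih)]
  have hCb : ∀ t ∈ C, |X ih - t| < R := by
    intro t ht
    by_contra h
    push Not at h
    exact absurd (hR t _ h) (not_lt.mpr ht)
  have hbb : BddBelow C := ⟨X ih - R, fun t ht => by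
    have := (abs_lt.mp (hCb t ht)).2; linarith⟩
  have hba : BddAbove C := ⟨X ih + R, fun t ht => by
    have := (abs_lt.mp (hCb t ht)).1; linarith⟩
  have htlC : tl ∈ C := htl ▸ hCcl.csInf_mem ⟨_, hXC⟩ hbb
  have htuC : tu ∈ C := htu ▸ hCcl.csSup_mem ⟨_, hXC⟩ hba
  have hrl0 : 0 ≤ rl := by
    have : tl ≤ X ih := htl ▸ csInf_le hbb hXC
    linarith
  have hru0 : 0 ≤ ru := by
    have : X ih ≤ tu := htu ▸ le_csSup hba hXC
    linarith
  have hGl : α = G tl := by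
    refine le_antisymm htlC (not_lt.mp fun hlt => ?_)
    have h1 : ∀ᶠ t in nhdsWithin tl (Set.Iio tl), α < G t :=
      ((hGc.tendsto tl).mono_left nhdsWithin_le_nhds).eventually_const_lt hlt
    obtain ⟨t, ht1, ht2⟩ := (h1.and self_mem_nhdsWithin).exists
    have : tl ≤ t := htl ▸ csInf_le hbb ht1.le
    exact absurd this (not_le.mpr ht2)
  have hGu : α = G tu := by
    refine le_antisymm htuC (not_lt.mp fun hlt => ?_)
    have h1 : ∀ᶠ t in nhdsWithin tu (Set.Ioi tu), α < G t :=
      ((hGc.tendsto tu).mono_left nhdsWithin_le_nhds).eventually_const_lt hlt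
    obtain ⟨t, ht1, ht2⟩ := (h1.and self_mem_nhdsWithin).exists
    have : t ≤ tu := htu ▸ le_csSup hba ht1.le
    exact absurd this (not_le.mpr ht2)
  constructor
  · rw [hGl]
    refine Finset.sum_congr rfl fun j _ => ?_
    rw [← hrl, abs_of_nonneg hrl0, hTS _ (le_max_of_le_left hrl0)]
    congr 1
    by_cases h : j = ih
    · subst h
      simp only [hc, if_true]
      rw [max_eq_left hrl0, max_eq_left (by linarith)]
    · simp only [hc, h, if_false]
      congr 2
      linarith
  · rw [hGu]
    refine Finset.sum_congr rfl fun j _ => ?_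
    rw [abs_sub_comm, ← hru, abs_of_nonneg hru0, hTS _ (le_max_of_le_left hru0)]
    congr 1
    by_cases h : j = ih
    · subst h
      simp only [hc, if_true]
      rw [max_eq_left hru0, max_eq_left (by linarith)]
    · simp only [hc, h, if_false]
      congr 2
      linarith
end
end

section
/- (Key lemma, top-k case.) Fix k with 1 ≤ k ≤ m. Let X ∈ ℝ^m have pairwise distinct coordinates with top-k indices î_(1), …, î_(k). Fix 𝐭 = (t_{î_(1)}, …, t_{î_(k)}) ∈ ℝ^k and let 𝐭_(k) = min_{j∈[k]} t_{î_(j)}. Define the worst-case vector θ^𝐭 by θ^𝐭_j = t_j for j ∈ {î_(1), …, î_(k)} and θ^𝐭_j = min{ (2/3)X_j + (1/3)𝐭_(k), 𝐭_(k) } otherwise. Then 𝐭 ∈ Ĉ^α_{î_(1),…,î_(k)} := { (θ_{î_(1)},…,θ_{î_(k)}) : θ ∈ ℝ^m, X ∈ A_α(θ) } if and only if max_{j∈[k]} |X_{î_(j)} − t_{î_(j)}| ≤ r_α(θ^𝐭). -/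
open Set

noncomputable section

/-- The `k`-th largest coordinate of `θ`. -/
def kth (m k : ℕ) (θ : Fin m → ℝ) : ℝ :=
  sSup {t : ℝ | k ≤ Set.ncard {j : Fin m | t ≤ θ j}}

/-- Top-`k` suboptimality gap `Δ^{(k)}_j(θ) = max{θ_(k) − θ_j, 0}`. -/
def gapk (m k : ℕ) (θ : Fin m → ℝ) (j : Fin m) : ℝ := max (kth m k θ - θ j) 0

/-- Top-`k` active radius `r_α(θ) = min {r ≥ 0 : 𝐒((max{r, Δ^{(k)}_j(θ)/2})_j) ≤ α}`. -/
def rAk (m k : ℕ) (S : (Fin m → ℝ) → ℝ) (α : ℝ) (θ : Fin m → ℝ) : ℝ :=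
  sInf {r : ℝ | 0 ≤ r ∧ S (fun j => max r (gapk m k θ j / 2)) ≤ α}

/-- Top-`k` acceptance-region membership: `x ∈ A_α(θ)`. -/
def acceptk (m k : ℕ) (S : (Fin m → ℝ) → ℝ) (α : ℝ) (θ x : Fin m → ℝ) : Prop :=
  ∀ j, |x j - θ j| ≤ max (rAk m k S α θ) (gapk m k θ j / 2)

/-- The worst-case vector `θ^𝐭` for the top-`k` problem: `θ^𝐭_{î_(a)} = t_a` and
`θ^𝐭_j = min{(2/3)X_j + (1/3)𝐭_(k), 𝐭_(k)}` for `j` outside the top `k`, where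
`𝐭_(k) = min_a t_a`. -/
def thetaTk (m k : ℕ) (X : Fin m → ℝ) (ihat : Fin k → Fin m) (t : Fin k → ℝ) :
    Fin m → ℝ :=
  fun j =>
    if h : ∃ a, ihat a = j then t h.choose
    else min (2 / 3 * X j + 1 / 3 * (⨅ a, t a)) (⨅ a, t a)

lemma aux_anti (m : ℕ) (S : (Fin m → ℝ) → ℝ)
    (hSanti : ∀ v : Fin m → ℝ, (∀ j, 0 ≤ v j) → ∀ (j : Fin m) (a b : ℝ),
      0 ≤ a → a < b → S (Function.update v j b) < S (Function.update v j a))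
    (v w : Fin m → ℝ) (hv : ∀ j, 0 ≤ v j) (hvw : ∀ j, v j ≤ w j) : S w ≤ S v := by
  have key : ∀ s : Finset (Fin m), S (s.piecewise w v) ≤ S v := by
    intro s
    induction s using Finset.induction_on with
    | empty => simp
    | insert j s hj ih =>
      refine le_trans ?_ ih
      rw [Finset.piecewise_insert]
      rcases (hvw j).eq_or_lt with h | h
      · have : Function.update (s.piecewise w v) j (w j) = s.piecewise w v := by
          rw [Function.update_eq_self_iff]
          simp [hj, h]
        rw [this]
      · have h1 := hSanti (s.piecewise w v) (by
          intro i
          by_cases hi : i ∈ s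
          · simp only [hi, Finset.piecewise_eq_of_mem]; exact (hv i).trans (hvw i)
          · simp only [hi, not_false_eq_true, Finset.piecewise_eq_of_notMem]; exact hv i)
          j (v j) (w j) (hv j) h
        have : Function.update (s.piecewise w v) j (v j) = s.piecewise w v := by
          rw [Function.update_eq_self_iff]
          simp [hj]
        rw [this] at h1
        exact h1.le
  simpa using key Finset.univ

lemma aux_strict (m : ℕ) (S : (Fin m → ℝ) → ℝ)
    (hSanti : ∀ v : Fin m → ℝ, (∀ j, 0 ≤ v j) → ∀ (j : Fin m) (a b : ℝ),
      0 ≤ a → a < b → S (Function.update v j b) < S (Function.update v j a))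
    (v w : Fin m → ℝ) (hv : ∀ j, 0 ≤ v j) (hvw : ∀ j, v j ≤ w j) (b : Fin m)
    (hb : v b < w b) : S w < S v := by
  have h1 := hSanti v hv b (v b) (w b) (hv b) hb
  rw [Function.update_eq_self] at h1
  refine lt_of_le_of_lt (aux_anti m S hSanti _ w ?_ ?_) h1
  · intro j
    by_cases h : j = b
    · subst h; simpa using (hv j).trans (hvw j)
    · simpa [h] using hv j
  · intro j
    by_cases h : j = b
    · subst h; simp
    · simpa [h] using hvw j

lemma gapk_nonneg (m k : ℕ) (θ : Fin m → ℝ) (j : Fin m) : 0 ≤ gapk m k θ j := le_max_right _ _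

lemma rAk_nonneg (m k : ℕ) (S : (Fin m → ℝ) → ℝ) (α : ℝ) (θ : Fin m → ℝ) :
    0 ≤ rAk m k S α θ := Real.sInf_nonneg (fun _ h => h.1)

lemma rAk_mono (m k : ℕ) (α : ℝ) (hα0 : 0 < α)
    (S : (Fin m → ℝ) → ℝ)
    (hScont : ContinuousOn S {v : Fin m → ℝ | ∀ j, 0 ≤ v j})
    (hSanti : ∀ v : Fin m → ℝ, (∀ j, 0 ≤ v j) → ∀ (j : Fin m) (a b : ℝ),
      0 ≤ a → a < b → S (Function.update v j b) < S (Function.update v j a))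
    (hSlim : ∀ ε : ℝ, 0 < ε → ∃ M : ℝ, ∀ v : Fin m → ℝ, (∀ j, M ≤ v j) → S v < ε)
    (θ θ' : Fin m → ℝ) (b : Fin m)
    (h1 : gapk m k θ b / 2 ≤ rAk m k S α θ) (h2 : gapk m k θ' b = 0)
    (h3 : ∀ j, gapk m k θ' j / 2 ≤ max (rAk m k S α θ) (gapk m k θ j / 2)) :
    rAk m k S α θ ≤ rAk m k S α θ' := by
  conv_rhs => unfold rAk
  apply le_csInf
  · obtain ⟨M, hM⟩ := hSlim α hα0
    exact ⟨max M 0, le_max_right _ _,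
      (hM _ (fun j => (le_max_left _ _).trans (le_max_left _ _))).le⟩
  rintro r' ⟨hr0, hr'⟩
  by_contra! hlt
  have hnn : ∀ (θ : Fin m → ℝ) j, 0 ≤ gapk m k θ j / 2 := fun θ j =>
    div_nonneg (gapk_nonneg m k θ j) (by norm_num)
  have hs : S (fun j => max (rAk m k S α θ) (gapk m k θ j / 2)) < α := by
    refine lt_of_lt_of_le (aux_strict m S hSanti _ _ ?_ ?_ b ?_) hr'
    · intro j; exact hr0.trans (le_max_left _ _)
    · intro j; exact max_le (hlt.le.trans (le_max_left _ _)) (h3 j)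
    · simp only [h2, zero_div, max_eq_left hr0, max_eq_left h1]; exact hlt
  have hc : Continuous (fun s : ℝ => (fun j => max s (gapk m k θ j / 2))) := by fun_prop
  have hc2 : Continuous (fun s : ℝ => S (fun j => max s (gapk m k θ j / 2))) :=
    hScont.comp_continuous hc (fun s j => (hnn θ j).trans (le_max_right _ _))
  have hev := (hc2.tendsto (rAk m k S α θ)).eventually_lt_const hs
  have hev2 := lt_mem_nhds (hr0.trans_lt hlt)
  obtain ⟨s, hs1, ⟨hs2, hs3⟩⟩ := ((hev.and hev2).filter_mono (nhdsWithin_le_nhds (s := Set.Iio (rAk m k S α θ))) |>.and self_mem_nhdsWithin).exists.imp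
    (fun s h => (⟨h.2, h.1⟩ : s ∈ Set.Iio (rAk m k S α θ) ∧ _))
  have : rAk m k S α θ ≤ s := csInf_le ⟨0, fun _ h => h.1⟩ ⟨le_of_lt hs3, le_of_lt hs2⟩
  exact absurd hs1 (not_lt.2 this)

lemma kth_bdd (m k : ℕ) (hk : 0 < k) (θ : Fin m → ℝ) :
    BddAbove {t : ℝ | k ≤ Set.ncard {j : Fin m | t ≤ θ j}} := by
  obtain ⟨B, hB⟩ := (Set.finite_range θ).bddAbove
  refine ⟨B, fun t ht => ?_⟩
  have ht' : k ≤ Set.ncard {j : Fin m | t ≤ θ j} := ht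
  obtain ⟨j, hj⟩ := Set.nonempty_of_ncard_ne_zero (s := {j : Fin m | t ≤ θ j}) (by omega)
  exact le_trans hj (hB ⟨j, rfl⟩)

lemma ncard_range_ihat (m k : ℕ) (ihat : Fin k → Fin m) (hinj : Function.Injective ihat) :
    (Set.range ihat).ncard = k := by
  rw [← Set.image_univ, Set.ncard_image_of_injective _ hinj]; simp

lemma kth_in (m k : ℕ) (ihat : Fin k → Fin m) (hinj : Function.Injective ihat)
    (θ : Fin m → ℝ) (τ : ℝ) (h : ∀ a, τ ≤ θ (ihat a)) :
    τ ∈ {t : ℝ | k ≤ Set.ncard {j : Fin m | t ≤ θ j}} := by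
  show k ≤ _
  conv_lhs => rw [← ncard_range_ihat m k ihat hinj]
  apply Set.ncard_le_ncard _ (Set.toFinite _)
  rintro _ ⟨a, rfl⟩
  exact h a

lemma kth_ge (m k : ℕ) (hk : 0 < k) (ihat : Fin k → Fin m) (hinj : Function.Injective ihat)
    (θ : Fin m → ℝ) (τ : ℝ) (h : ∀ a, τ ≤ θ (ihat a)) : τ ≤ kth m k θ :=
  le_csSup (kth_bdd m k hk θ) (kth_in m k ihat hinj θ τ h)

lemma kth_attained (m k : ℕ) (hk : 0 < k) (ihat : Fin k → Fin m) (hinj : Function.Injective ihat)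
    (θ : Fin m → ℝ) (τ : ℝ) (h : ∀ a, τ ≤ θ (ihat a)) :
    k ≤ Set.ncard {j : Fin m | kth m k θ ≤ θ j} := by
  have hcl := csSup_mem_closure ⟨τ, kth_in m k ihat hinj θ τ h⟩ (kth_bdd m k hk θ)
  change kth m k θ ∈ _ at hcl
  rw [mem_closure_iff_frequently] at hcl
  have hev : ∀ᶠ x in nhds (kth m k θ), ∀ j, θ j < kth m k θ → θ j < x := by
    rw [Filter.eventually_all]
    intro j
    by_cases hj : θ j < kth m k θ
    · filter_upwards [lt_mem_nhds hj] with x hx _ using hx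
    · exact Filter.Eventually.of_forall (fun x h => absurd h hj)
  obtain ⟨x, hx1, hx2⟩ := (hcl.and_eventually hev).exists
  refine le_trans hx1 (Set.ncard_le_ncard ?_ (Set.toFinite _))
  intro j hj
  by_contra hc
  exact absurd (hx2 j (not_le.1 hc)) (not_lt.2 hj)

lemma exists_out (m k : ℕ) (hk : 0 < k) (ihat : Fin k → Fin m) (hinj : Function.Injective ihat)
    (θ : Fin m → ℝ) (τ : ℝ) (h : ∀ a, τ ≤ θ (ihat a)) (b : Fin k) (hb : θ (ihat b) = τ)
    (hlt : τ < kth m k θ) : ∃ j, j ∉ Set.range ihat ∧ kth m k θ ≤ θ j := by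
  by_contra! hc
  have h1 := kth_attained m k hk ihat hinj θ τ h
  have h2 : {j : Fin m | kth m k θ ≤ θ j} ⊂ Set.range ihat := by
    refine ⟨fun j hj => ?_, fun hsub => ?_⟩
    · by_contra hn
      exact absurd (hc j hn) (not_lt.2 hj)
    · have : kth m k θ ≤ θ (ihat b) := hsub ⟨b, rfl⟩
      linarith
  have h3 := Set.ncard_lt_ncard h2 (Set.toFinite _)
  rw [ncard_range_ihat m k ihat hinj] at h3
  omega

/-- **Key lemma, top-k case.** `𝐭 ∈ Ĉ^α_{î_(1),…,î_(k)}` if and only if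
`max_a |X_{î_(a)} − t_a| ≤ r_α(θ^𝐭)`. -/
theorem zoom_key_lemma_topk
    (m k : ℕ) (hm : 0 < m) (hk : 0 < k) (hkm : k ≤ m)
    (α : ℝ) (hα0 : 0 < α) (hα1 : α < 1)
    (S : (Fin m → ℝ) → ℝ)
    (hS0 : ∀ v : Fin m → ℝ, (∀ j, 0 ≤ v j) → 0 ≤ S v)
    (hScont : ContinuousOn S {v : Fin m → ℝ | ∀ j, 0 ≤ v j})
    (hSanti : ∀ v : Fin m → ℝ, (∀ j, 0 ≤ v j) → ∀ (j : Fin m) (a b : ℝ),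
      0 ≤ a → a < b → S (Function.update v j b) < S (Function.update v j a))
    (hSlim : ∀ ε : ℝ, 0 < ε → ∃ M : ℝ, ∀ v : Fin m → ℝ, (∀ j, M ≤ v j) → S v < ε)
    (X : Fin m → ℝ) (hXinj : Function.Injective X)
    (ihat : Fin k → Fin m) (hinj : Function.Injective ihat)
    (hdec : ∀ a b : Fin k, a < b → X (ihat b) < X (ihat a))
    (hout : ∀ j, j ∉ Set.range ihat → ∀ a, X j < X (ihat a))
    (t : Fin k → ℝ) :
    (∃ θ : Fin m → ℝ, acceptk m k S α θ X ∧ ∀ a, θ (ihat a) = t a) ↔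
      ∀ a, |X (ihat a) - t a| ≤ rAk m k S α (thetaTk m k X ihat t) := by
  haveI : Nonempty (Fin k) := ⟨⟨0, hk⟩⟩
  obtain ⟨b, hb⟩ := exists_eq_ciInf_of_finite (f := t)
  have hle : ∀ a, (⨅ a, t a) ≤ t a := fun a => ciInf_le (Set.finite_range t).bddBelow a
  have hin : ∀ a, thetaTk m k X ihat t (ihat a) = t a := by
    intro a
    have hex : ∃ a', ihat a' = ihat a := ⟨a, rfl⟩
    have := hinj hex.choose_spec
    unfold thetaTk
    rw [dif_pos hex, this]
  have hot : ∀ j, j ∉ Set.range ihat → thetaTk m k X ihat t j =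
      min (2 / 3 * X j + 1 / 3 * (⨅ a, t a)) (⨅ a, t a) := by
    intro j hj
    unfold thetaTk
    rw [dif_neg (by simpa using hj)]
  generalize hτ : (⨅ a, t a) = τ at *
  generalize thetaTk m k X ihat t = Θ at *
  have hkge : τ ≤ kth m k Θ := kth_ge m k hk ihat hinj Θ τ (fun a => by rw [hin]; exact hle a)
  have hk0 : kth m k Θ = τ := by
    refine le_antisymm ?_ hkge
    by_contra! hc
    obtain ⟨j, hj, hj2⟩ := exists_out m k hk ihat hinj Θ τ (fun a => by rw [hin]; exact hle a) b
      (by rw [hin, hb]) hc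
    rw [hot j hj] at hj2
    have := min_le_right (2 / 3 * X j + 1 / 3 * τ) τ
    linarith
  have hg0 : ∀ a, gapk m k Θ (ihat a) = 0 := by
    intro a
    unfold gapk
    rw [hk0, hin]
    exact max_eq_right (by linarith [hle a])
  constructor
  · rintro ⟨θ, hacc, hθ⟩ a
    have hge : τ ≤ kth m k θ := kth_ge m k hk ihat hinj θ τ (fun a => by rw [hθ]; exact hle a)
    have hr0 := rAk_nonneg m k S α θ
    have hsmall : (kth m k θ - τ) / 2 ≤ rAk m k S α θ := by
      rcases hge.eq_or_lt with h | h
      · rw [← h]; simpa using hr0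
      · obtain ⟨j, hj, hj2⟩ := exists_out m k hk ihat hinj θ τ
          (fun a => by rw [hθ]; exact hle a) b (by rw [hθ, hb]) h
        have hj3 := hacc j
        have hg : gapk m k θ j = 0 := max_eq_right (by linarith)
        rw [hg, zero_div, max_eq_left hr0] at hj3
        have hb3 := hacc (ihat b)
        have hgb : gapk m k θ (ihat b) = kth m k θ - τ := by
          unfold gapk
          rw [hθ, hb]; exact max_eq_left (by linarith)
        rw [hgb, hθ, hb] at hb3
        by_contra! hc
        rw [max_eq_right hc.le] at hb3
        have := hout j hj b
        have h5 := (abs_le.1 hj3).1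
        have h6 := (abs_le.1 hb3).2
        linarith
    have hgs : ∀ a, gapk m k θ (ihat a) / 2 ≤ rAk m k S α θ := by
      intro a
      have : gapk m k θ (ihat a) ≤ kth m k θ - τ := by
        unfold gapk
        rw [hθ]
        exact max_le (by linarith [hle a]) (by linarith)
      linarith
    have hmono : rAk m k S α θ ≤ rAk m k S α Θ := by
      refine rAk_mono m k α hα0 S hScont hSanti hSlim θ Θ (ihat b) (hgs b) (hg0 b) ?_
      intro j
      by_cases hj : j ∈ Set.range ihat
      · obtain ⟨a, rfl⟩ := hj
        rw [hg0, zero_div]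
        exact hr0.trans (le_max_left _ _)
      · have h1 := (abs_le.1 (hacc j)).1
        have h2 : gapk m k θ j / 2 ≤ max (rAk m k S α θ) (gapk m k θ j / 2) := le_max_right _ _
        have h3 : kth m k θ - θ j ≤ gapk m k θ j := le_max_left _ _
        have h4 : 0 ≤ max (rAk m k S α θ) (gapk m k θ j / 2) := hr0.trans (le_max_left _ _)
        generalize max (rAk m k S α θ) (gapk m k θ j / 2) = M at *
        have : gapk m k Θ j ≤ 2 * M := by
          unfold gapk
          rw [hk0, hot j hj]
          refine max_le ?_ (by linarith)
          rcases min_cases (2 / 3 * X j + 1 / 3 * τ) τ with h | h <;> linarith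
        linarith
    have := hacc (ihat a)
    rw [max_eq_left (hgs a), hθ] at this
    exact this.trans hmono
  · intro h
    refine ⟨Θ, ?_, hin⟩
    intro j
    by_cases hj : j ∈ Set.range ihat
    · obtain ⟨a, rfl⟩ := hj
      rw [hin]
      exact (h a).trans (le_max_left _ _)
    · rcases le_total (X j) τ with hx | hx
      · refine le_trans ?_ (le_max_right _ _)
        have h1 : kth m k Θ - Θ j ≤ gapk m k Θ j := le_max_left _ _
        rw [hk0] at h1
        have h2 : Θ j = 2 / 3 * X j + 1 / 3 * τ := by
          rw [hot j hj]; exact min_eq_left (by linarith)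
        rw [abs_le]
        constructor <;> linarith
      · refine le_trans ?_ (le_max_left _ _)
        have h2 : Θ j = τ := by
          rw [hot j hj]; exact min_eq_right (by linarith)
        have h3 := (abs_le.1 (h b)).2
        have h4 := hout j hj b
        rw [h2, abs_le]
        rw [hb] at h3
        constructor <;> linarith
end
end
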